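/- arXiv:1912.06909 — 3 statements merged into one kernel-verified Lean document; each statement's English description precedes it below -/
import Mathlib

section
/- For every strict preference profile P, the core from random endowments equals the random priority rule: for every allocation x, the number of endowment profiles ω with TTC^ω(P) = x equals the number of orders f on N with SP^f(P) = x. -/
/- Preferences are given by rank functions: `rk i o` is agent `i`'s rank of object `o`
(lower rank = more preferred), so `o P_i o'` iff `rk i o < rk i o'`. -/

/-- Find the smallest index `t` such that the `t`-th agent prefers the `t`-th object
to the `(t+1)`-st object; the last index always qualifies. -/
def findIdx2 {n : ℕ} (rk : Fin n → Fin n → Fin n) : List (Fin n) → List (Fin n) → ℕ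
  | a :: as, o1 :: o2 :: os =>
      if rk a o1 < rk a o2 then 0 else findIdx2 rk as (o2 :: os) + 1
  | _, _ => 0

/-- One run of the (ascending) crawler: `agents` is the list of remaining agents in the
order of their current ownership, `objects` the list of remaining objects in increasing
`≺`-order (the `t`-th agent currently owns the `t`-th object). -/
def crawlAux {n : ℕ} (rk : Fin n → Fin n → Fin n) :
    ℕ → List (Fin n) → List (Fin n) → List (Fin n × Fin n)
  | 0, _, _ => []
  | fuel + 1, agents, objects =>
    match agents, objects with
    | a0 :: _, o0 :: _ =>
      let t := findIdx2 rk agents objects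
      let a := agents.getD t a0
      let ostar := (objects.argmin (rk a)).getD o0
      (a, ostar) :: crawlAux rk fuel (agents.eraseIdx t) (objects.erase ostar)
    | _, _ => []

/-- Agents listed in increasing order of their endowments. -/
def ownersList {n : ℕ} (ω : Fin n → Fin n) : List (Fin n) :=
  (List.finRange n).filterMap fun o => (List.finRange n).find? fun a => ω a == o

/-- The (ascending) crawler allocation. -/
def CRfun {n : ℕ} (rk : Fin n → Fin n → Fin n) (ω : Fin n → Fin n) (i : Fin n) : Fin n :=
  ((crawlAux rk n (ownersList ω) (List.finRange n)).lookup i).getD (ω i)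

/-- The descending crawler: the mirror image of the ascending crawler, obtained by
reversing the order `≺` on objects. -/
def DCRfun {n : ℕ} (rk : Fin n → Fin n → Fin n) (ω : Fin n → Fin n) (i : Fin n) : Fin n :=
  Fin.rev (CRfun (fun j o => rk j o.rev) (fun j => (ω j).rev) i)

/-- Sequential priority: agents in the given list pick, in order, their most
preferred remaining object. -/
def SPAux {n : ℕ} (rk : Fin n → Fin n → Fin n) :
    List (Fin n) → List (Fin n) → List (Fin n × Fin n)
  | [], _ => []
  | _ :: _, [] => []
  | a :: as, o0 :: os =>
      let o := ((o0 :: os).argmin (rk a)).getD o0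
      (a, o) :: SPAux rk as ((o0 :: os).erase o)

/-- The sequential priority rule induced by the order `f` (agent `f k` has priority `k`). -/
def SPfun {n : ℕ} (rk : Fin n → Fin n → Fin n) (f : Fin n → Fin n) (i : Fin n) : Fin n :=
  ((SPAux rk ((List.finRange n).map f) (List.finRange n)).lookup i).getD i

/-- Top trading cycles: `own` maps each remaining object to its (initial) owner. -/
def TTCAux {n : ℕ} (rk : Fin n → Fin n → Fin n) :
    ℕ → List (Fin n) → List (Fin n) → (Fin n → Fin n) → List (Fin n × Fin n)
  | 0, _, _, _ => []
  | fuel + 1, agents, objects, own =>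
    match agents with
    | [] => []
    | a0 :: _ =>
      let top : Fin n → Fin n := fun a => (objects.argmin (rk a)).getD a0
      let ptr : Fin n → Fin n := fun a => own (top a)
      let onCyc : Fin n → Bool := fun a =>
        (List.range agents.length).any fun k => ptr^[k + 1] a == a
      let cyc := agents.filter onCyc
      let assigned := cyc.map top
      (cyc.map fun a => (a, top a)) ++
        TTCAux rk fuel (agents.filter fun a => !onCyc a)
          (objects.filter fun o => !(assigned.contains o)) own

/-- The top trading cycles allocation from endowments `ω`. -/
def TTCfun {n : ℕ} (rk : Fin n → Fin n → Fin n) (ω : Equiv.Perm (Fin n)) (i : Fin n) : Fin n :=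
  ((TTCAux rk n (List.finRange n) (List.finRange n) ω.symm).lookup i).getD (ω i)

/-- A profile of strict preferences (given as rank permutations) is single-peaked
with respect to the order on `Fin n`. -/
def SinglePeaked {n : ℕ} (P : Fin n → Equiv.Perm (Fin n)) : Prop :=
  ∀ i : Fin n, ∃ p : Fin n, ∀ o o' : Fin n,
    ((o' < o ∧ o ≤ p) ∨ (p ≤ o ∧ o < o')) → P i o < P i o'

/-- Pareto efficiency of an allocation `x` at the profile `P`. -/
def ParetoEfficient {n : ℕ} (P : Fin n → Equiv.Perm (Fin n)) (x : Fin n → Fin n) : Prop :=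
  ¬ ∃ y : Equiv.Perm (Fin n),
      (∀ i, P i (y i) ≤ P i (x i)) ∧ ∃ j, P j (y j) < P j (x j)

/-- The agents of `W` without an `R`-successor in `W`. -/
def relSinks {α : Type*} (R : α → α → Prop) [DecidableRel R] (W : Finset α) : Finset α :=
  W.filter fun i => ∀ j ∈ W, ¬ R i j

theorem mem_relSinks {α : Type*} {R : α → α → Prop} [DecidableRel R] {W : Finset α} {i : α} :
    i ∈ relSinks R W ↔ i ∈ W ∧ ∀ j ∈ W, ¬ R i j :=
  Finset.mem_filter

theorem relSinks_subset {α : Type*} (R : α → α → Prop) [DecidableRel R] (W : Finset α) :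
    relSinks R W ⊆ W :=
  Finset.filter_subset _ _

/-- The largest `σ`-invariant subset of `S`. -/
def invariantKernel {α : Type*} [Fintype α] [DecidableEq α] (S : Finset α)
    (σ : Equiv.Perm α) : Finset α :=
  Finset.univ.filter fun a => ∀ b, σ.SameCycle a b → b ∈ S

/-- There is a level function on `W`, constant along `σ` and strictly decreasing along `R`;
that is, contracting the cycles of `σ` turns `R` into an acyclic relation on `W`. -/
def IsLevelled {α : Type*} (R : α → α → Prop) (σ : Equiv.Perm α) (W : Finset α) : Prop :=
  ∃ h : α → ℕ, (∀ i ∈ W, h (σ i) = h i) ∧ ∀ i ∈ W, ∀ j ∈ W, R i j → h j < h i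

theorem apply_mem_iff_of_fixes {α : Type*} {W : Finset α} {σ : Equiv.Perm α}
    (hσ : ∀ i ∉ W, σ i = i) (i : α) :
    σ i ∈ W ↔ i ∈ W := by
  by_cases hi : i ∈ W
  · refine iff_of_true ?_ hi
    by_contra h
    exact h (by rwa [σ.injective (hσ _ h)])
  · rw [hσ i hi]

theorem IsLevelled.erase {α : Type*} [DecidableEq α] {R : α → α → Prop} {W : Finset α}
    {σ : Equiv.Perm α} (hfix : ∀ i ∉ W, σ i = i)
    (h : IsLevelled R σ W) (s : α) :
    IsLevelled R (Equiv.swap s (σ s) * σ) (W.erase s) := by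
  obtain ⟨h, hinv, hdec⟩ := h
  have hinv' : ∀ i, h (σ i) = h i := fun i => by
    by_cases hi : i ∈ W
    · exact hinv i hi
    · rw [hfix i hi]
  refine ⟨h, fun i hi => ?_, fun i hi j hj =>
    hdec i (Finset.mem_of_mem_erase hi) j (Finset.mem_of_mem_erase hj)⟩
  rw [Equiv.Perm.mul_apply, ← hinv' i, Equiv.swap_apply_def]
  split_ifs with h1 h2
  · rw [h1, hinv']
  · rw [h2, hinv']
  · rfl

/-- Inserting the fixed point `s` of `τ` after an element `a` turns an invariant set `B`
into the invariant set `insert s B`, provided the latter contains `a`. -/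
theorem apply_mem_insert_iff {α : Type*} [DecidableEq α] {τ : Equiv.Perm α} {s a : α}
    {B : Finset α} (hs : τ s = s) (ha : a ∈ insert s B)
    (hB : ∀ b, τ b ∈ B ↔ b ∈ B) (b : α) :
    (Equiv.swap s (τ a) * τ) b ∈ insert s B ↔ b ∈ insert s B := by
  have ha' : τ a ∈ insert s B := by
    rcases Finset.mem_insert.1 ha with rfl | h
    · simp [hs]
    · exact Finset.mem_insert_of_mem ((hB a).2 h)
  have hb : τ b ∈ insert s B ↔ b ∈ insert s B := by
    rw [Finset.mem_insert, Finset.mem_insert, hB]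
    exact or_congr_left ⟨fun h => τ.injective (h.trans hs.symm), fun h => h ▸ hs⟩
  rw [Equiv.Perm.mul_apply, ← hb]
  by_cases h1 : τ b = s
  · rw [h1, Equiv.swap_apply_left]
    simp only [ha', Finset.mem_insert_self]
  · by_cases h2 : τ b = τ a
    · rw [h2, Equiv.swap_apply_right]
      simp only [ha', Finset.mem_insert_self]
    · rw [Equiv.swap_apply_of_ne_of_ne h1 h2]

section Permutations

variable {α : Type*} [Fintype α] [DecidableEq α]

theorem invariantKernel_subset (S : Finset α) (σ : Equiv.Perm α) : invariantKernel S σ ⊆ S := by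
  intro a ha
  exact (Finset.mem_filter.1 ha).2 a (Equiv.Perm.SameCycle.refl σ a)

theorem apply_mem_invariantKernel {S : Finset α} {σ : Equiv.Perm α} {a : α} :
    σ a ∈ invariantKernel S σ ↔ a ∈ invariantKernel S σ := by
  simp [invariantKernel]

theorem subset_invariantKernel {S B : Finset α} {σ : Equiv.Perm α} (hBS : B ⊆ S)
    (hB : ∀ b, σ b ∈ B ↔ b ∈ B) : B ⊆ invariantKernel S σ := by
  intro a ha
  refine Finset.mem_filter.2 ⟨Finset.mem_univ _, ?_⟩
  rintro b ⟨k, rfl⟩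
  refine hBS ?_
  induction k using Int.induction_on with
  | zero => simpa using ha
  | succ k ih => rwa [add_comm, zpow_add, zpow_one, Equiv.Perm.mul_apply, hB]
  | pred k ih =>
    rw [← hB, ← Equiv.Perm.mul_apply, ← zpow_one_add]
    simpa using ih

theorem invariantKernel_swap_mul_subset {S : Finset α} {τ : Equiv.Perm α} {s a : α}
    (hs : τ s = s) :
    invariantKernel S (Equiv.swap s (τ a) * τ) ⊆
      insert s (invariantKernel (S.erase s) τ) := by
  set σ := Equiv.swap s (τ a) * τ with hσ
  rw [Finset.subset_insert_iff]
  refine subset_invariantKernel (Finset.erase_subset_erase _ (invariantKernel_subset _ _)) ?_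
  intro b
  by_cases hbs : b = s
  · simp [hbs, hs]
  have hτb : τ b ≠ s := fun h => hbs (τ.injective (h.trans hs.symm))
  simp only [Finset.mem_erase, ne_eq, hbs, hτb, not_false_eq_true, true_and]
  by_cases hba : b = a
  · have h1 : σ b = s := by simp [hσ, hba]
    have h2 : σ s = τ b := by simp [hσ, hs, hba]
    rw [← h2, apply_mem_invariantKernel, ← h1, apply_mem_invariantKernel]
  · have h1 : σ b = τ b := by
      rw [hσ, Equiv.Perm.mul_apply,
        Equiv.swap_apply_of_ne_of_ne hτb (fun h => hba (τ.injective h))]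
    rw [← h1, apply_mem_invariantKernel]

theorem invariantKernel_swap_mul {S : Finset α} {τ : Equiv.Perm α} {s a : α} (hsS : s ∈ S)
    (hs : τ s = s) (ha : a ∈ insert s (invariantKernel (S.erase s) τ)) :
    invariantKernel S (Equiv.swap s (τ a) * τ) =
      insert s (invariantKernel (S.erase s) τ) :=
  Finset.Subset.antisymm (invariantKernel_swap_mul_subset hs)
    (subset_invariantKernel
      (Finset.insert_subset hsS
        ((invariantKernel_subset _ _).trans (Finset.erase_subset _ _)))
      (apply_mem_insert_iff hs ha fun _ => apply_mem_invariantKernel))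

variable {R : α → α → Prop} [DecidableRel R] {W : Finset α}

theorem IsLevelled.swap_mul {τ : Equiv.Perm α} {s a : α}
    (hs : s ∈ relSinks R W) (hτs : τ s = s)
    (ha : a ∈ insert s (invariantKernel ((relSinks R W).erase s) τ))
    (h : IsLevelled R τ (W.erase s)) : IsLevelled R (Equiv.swap s (τ a) * τ) W := by
  obtain ⟨h, hinv, hdec⟩ := h
  set C := insert s (invariantKernel ((relSinks R W).erase s) τ) with hC
  have hCinv := apply_mem_insert_iff hτs ha fun b => apply_mem_invariantKernel
  rw [← hC] at hCinv
  have hsC : s ∈ C := Finset.mem_insert_self _ _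
  have hCS : C ⊆ relSinks R W := Finset.insert_subset hs
    ((invariantKernel_subset _ _).trans (Finset.erase_subset _ _))
  refine ⟨fun i => if i ∈ C then 0 else h i + 1, fun i hi => ?_, fun i hi j hj hij => ?_⟩
  · by_cases hiC : i ∈ C
    · simp only [hCinv i, hiC, if_true]
    · simp only [hCinv i, hiC, if_false, add_left_inj]
      have his : i ≠ s := fun h => hiC (h ▸ hsC)
      have hia : i ≠ a := fun h => hiC (h ▸ ha)
      rw [Equiv.Perm.mul_apply, Equiv.swap_apply_of_ne_of_ne
        (fun h => his (τ.injective (h.trans hτs.symm))) (fun h => hia (τ.injective h))]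
      exact hinv i (Finset.mem_erase.2 ⟨his, hi⟩)
  · have hiC : i ∉ C := fun h => (mem_relSinks.1 (hCS h)).2 j hj hij
    by_cases hjC : j ∈ C
    · simp [hiC, hjC]
    · simp only [hiC, hjC, if_false, add_lt_add_iff_right]
      exact hdec i (Finset.mem_erase.2 ⟨fun h => hiC (h ▸ hsC), hi⟩) j
        (Finset.mem_erase.2 ⟨fun h => hjC (h ▸ hsC), hj⟩) hij

theorem IsLevelled.invariantKernel_nonempty {σ : Equiv.Perm α} (hfix : ∀ i ∉ W, σ i = i)
    (h : IsLevelled R σ W) (hW : W.Nonempty) :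
    (invariantKernel (relSinks R W) σ).Nonempty := by
  obtain ⟨h, hinv, hdec⟩ := h
  obtain ⟨m, hm, hmin⟩ := W.exists_min_image h hW
  have hsub : W.filter (fun i => h i = h m) ⊆ invariantKernel (relSinks R W) σ := by
    refine subset_invariantKernel (fun i hi => ?_) (fun i => ?_)
    · rw [Finset.mem_filter] at hi
      refine mem_relSinks.2 ⟨hi.1, fun j hj hij => ?_⟩
      have := hdec i hi.1 j hj hij
      have := hmin j hj
      omega
    · simp only [Finset.mem_filter, apply_mem_iff_of_fixes hfix]
      exact and_congr_right fun hi => by rw [hinv i hi]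
  exact ⟨m, hsub (Finset.mem_filter.2 ⟨hm, rfl⟩)⟩

end Permutations

open Classical in
/-- The permutations supported in `W` whose cycles contract `R` to an acyclic relation. -/
noncomputable def levelledPerms {α : Type*} [Fintype α] (R : α → α → Prop) (W : Finset α) :
    Finset (Equiv.Perm α) :=
  Finset.univ.filter fun σ => (∀ i ∉ W, σ i = i) ∧ IsLevelled R σ W

open Classical in
/-- The enumerations of `W` in which every agent comes after all its `R`-successors. -/
noncomputable def linearExtensions {α : Type*} (R : α → α → Prop) (W : Finset α) :
    Finset (List α) :=
  W.val.lists.toFinset.filter fun l => l.Pairwise fun a b => ¬ R a b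

theorem mem_levelledPerms {α : Type*} [Fintype α] {R : α → α → Prop} {W : Finset α}
    {σ : Equiv.Perm α} :
    σ ∈ levelledPerms R W ↔ (∀ i ∉ W, σ i = i) ∧ IsLevelled R σ W := by
  simp [levelledPerms]

theorem mem_linearExtensions {α : Type*} {R : α → α → Prop} {W : Finset α} {l : List α} :
    l ∈ linearExtensions R W ↔
      (l : Multiset α) = W.val ∧ l.Pairwise fun a b => ¬ R a b := by
  simp [linearExtensions, eq_comm]

theorem card_linearExtensions {α : Type*} [DecidableEq α] {R : α → α → Prop}
    [DecidableRel R] {W : Finset α} (hR : ∀ i, ¬ R i i)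
    (hW : W.Nonempty) :
    (linearExtensions R W).card =
      ∑ s ∈ relSinks R W, (linearExtensions R (W.erase s)).card := by
  rw [← Finset.card_sigma]
  symm
  refine Finset.card_bij (fun p _ => p.1 :: p.2) ?_ ?_ ?_
  · rintro ⟨s, l⟩ hp
    simp only [Finset.mem_sigma, mem_linearExtensions, mem_relSinks] at hp
    obtain ⟨⟨hs, hsink⟩, hl, hpw⟩ := hp
    refine mem_linearExtensions.2 ⟨?_, List.pairwise_cons.2 ⟨fun b hb => hsink b ?_, hpw⟩⟩
    · rw [← Multiset.cons_coe, hl, Finset.erase_val, Multiset.cons_erase hs]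
    · rw [← Multiset.mem_coe, hl] at hb
      exact Finset.mem_of_mem_erase hb
  · rintro ⟨s, l⟩ - ⟨t, m⟩ - h
    simp_all
  · intro l hl
    rw [mem_linearExtensions] at hl
    obtain ⟨hl, hpw⟩ := hl
    cases l with
    | nil =>
      obtain ⟨a, ha⟩ := hW
      rw [← Finset.mem_val, ← hl] at ha
      simp at ha
    | cons s l =>
      have hs : s ∈ W := by rw [← Finset.mem_val, ← hl]; simp
      rw [List.pairwise_cons] at hpw
      have herase : (l : Multiset α) = (W.erase s).val := by
        rw [Finset.erase_val, ← hl]; simp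
      have hnd : s ∉ l := by
        rw [← Multiset.mem_coe, herase]; exact Finset.notMem_erase _ _
      refine ⟨⟨s, l⟩, ?_, rfl⟩
      rw [Finset.mem_sigma, mem_linearExtensions]
      refine ⟨mem_relSinks.2 ⟨hs, fun j hj hsj => ?_⟩, herase, hpw.2⟩
      rw [← Finset.mem_val, ← hl, Multiset.mem_coe, List.mem_cons] at hj
      rcases hj with rfl | hj
      · exact hR _ hsj
      · exact hpw.1 j hj hsj

section Counting

variable {α : Type*} [Fintype α] [LinearOrder α] {R : α → α → Prop} [DecidableRel R]
  {W : Finset α}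

theorem card_levelledPerms (hW : W.Nonempty) :
    (levelledPerms R W).card = ∑ s ∈ relSinks R W, (levelledPerms R (W.erase s)).card := by
  rw [← Finset.card_sigma]
  symm
  let S := relSinks R W
  let first : (Σ _ : α, Equiv.Perm α) → α := fun p =>
    (insert p.1 (invariantKernel (S.erase p.1) p.2)).min' (Finset.insert_nonempty _ _)
  have hfirst : ∀ p, first p ∈ insert p.1 (invariantKernel (S.erase p.1) p.2) :=
    fun p => Finset.min'_mem _ _
  have hfix : ∀ p ∈ (relSinks R W).sigma fun s => levelledPerms R (W.erase s),
      p.1 ∈ S ∧ p.2 p.1 = p.1 := fun p hp => by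
    rw [Finset.mem_sigma, mem_levelledPerms] at hp
    exact ⟨hp.1, hp.2.1 _ (Finset.notMem_erase _ _)⟩
  refine Finset.card_bij (fun p _ => Equiv.swap p.1 (p.2 (first p)) * p.2) ?_ ?_ ?_
  · intro p hp
    obtain ⟨hpS, hpp⟩ := hfix p hp
    rw [Finset.mem_sigma, mem_levelledPerms] at hp
    have hsub : insert p.1 (invariantKernel (S.erase p.1) p.2) ⊆ W :=
      (Finset.insert_subset hpS ((invariantKernel_subset _ _).trans
        (Finset.erase_subset _ _))).trans (relSinks_subset _ _)
    refine mem_levelledPerms.2 ⟨fun i hi => ?_, hp.2.2.swap_mul hpS hpp (hfirst p)⟩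
    have hpi : p.2 i = i := hp.2.1 i fun h => hi (Finset.mem_of_mem_erase h)
    rw [Equiv.Perm.mul_apply, Equiv.swap_apply_of_ne_of_ne, hpi]
    · rw [hpi]
      rintro rfl
      exact hi (hsub (Finset.mem_insert_self _ _))
    · exact fun h => hi (p.2.injective h ▸ hsub (hfirst p))
  · intro p hp q hq hpq
    obtain ⟨hpS, hpp⟩ := hfix p hp
    obtain ⟨hqS, hqq⟩ := hfix q hq
    have hk := (invariantKernel_swap_mul hpS hpp (hfirst p)).symm.trans
      ((congrArg (invariantKernel S) hpq).trans (invariantKernel_swap_mul hqS hqq (hfirst q)))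
    have hf : first p = first q := by simp only [first, hk]
    have h1 : p.1 = q.1 := by
      have h := congrArg (fun σ : Equiv.Perm α => σ (first p)) hpq
      rw [hf] at h
      simpa [← hf] using h
    have h2 : p.2 (first p) = q.2 (first q) := by
      have h := congrArg (fun σ : Equiv.Perm α => σ p.1) hpq
      simp only [Equiv.Perm.mul_apply] at h
      rw [hpp, Equiv.swap_apply_left, h1, hqq, Equiv.swap_apply_left] at h
      exact h
    rw [h1, h2] at hpq
    exact Sigma.ext h1 (heq_of_eq (mul_left_cancel hpq))
  · intro σ hσ
    obtain ⟨hσW, hlev⟩ := mem_levelledPerms.1 hσ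
    have hne := hlev.invariantKernel_nonempty hσW hW
    set a := (invariantKernel S σ).min' hne with ha
    have haK : a ∈ invariantKernel S σ := Finset.min'_mem _ _
    have hsK : σ a ∈ invariantKernel S σ := apply_mem_invariantKernel.2 haK
    have hsS : σ a ∈ S := invariantKernel_subset _ _ hsK
    set τ := Equiv.swap (σ a) (σ (σ a)) * σ with hτ
    have hτa : τ a = σ (σ a) := by simp [hτ]
    have hτs : τ (σ a) = σ a := by simp [hτ]
    have hστ : Equiv.swap (σ a) (τ a) * τ = σ := by
      rw [hτa, hτ, ← mul_assoc, Equiv.swap_mul_self, one_mul]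
    have hmem : a ∈ insert (σ a) (invariantKernel (S.erase (σ a)) τ) := by
      have hsub := invariantKernel_swap_mul_subset (S := S) (a := a) hτs
      rw [hστ] at hsub
      exact hsub haK
    have hK := invariantKernel_swap_mul hsS hτs hmem
    rw [hστ] at hK
    have hf : first ⟨σ a, τ⟩ = a := by
      simp only [first, ha]
      congr 1
      exact hK.symm
    refine ⟨⟨σ a, τ⟩, ?_, by simp only [hf, hστ]⟩
    refine Finset.mem_sigma.2 ⟨hsS, mem_levelledPerms.2 ⟨fun i hi => ?_, hlev.erase hσW _⟩⟩
    by_cases his : i = σ a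
    · rw [his, hτs]
    · have hiW : i ∉ W := fun h => hi (Finset.mem_erase.2 ⟨his, h⟩)
      have hsi : σ (σ a) ≠ i := fun h =>
        hiW (h ▸ (apply_mem_iff_of_fixes hσW _).2 (relSinks_subset _ _ hsS))
      show Equiv.swap (σ a) (σ (σ a)) (σ i) = i
      rw [hσW i hiW, Equiv.swap_apply_of_ne_of_ne his hsi.symm]

/-- The number of permutations whose cycles contract `R` to an acyclic relation is the number
of linear extensions of `R`. -/
theorem card_levelledPerms_eq_card_linearExtensions (hR : ∀ i, ¬ R i i) (W : Finset α) :
    (levelledPerms R W).card = (linearExtensions R W).card := by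
  induction W using Finset.strongInduction with
  | H W ih =>
    rcases W.eq_empty_or_nonempty with rfl | hW
    · have h1 : levelledPerms R (∅ : Finset α) = {1} := by
        ext σ
        simp [mem_levelledPerms, IsLevelled, Equiv.ext_iff]
      have h2 : linearExtensions R (∅ : Finset α) = {[]} := by
        ext l
        simp +contextual [mem_linearExtensions]
      rw [h1, h2, Finset.card_singleton, Finset.card_singleton]
    · rw [card_levelledPerms hW, card_linearExtensions hR hW]
      exact Finset.sum_congr rfl fun s hs =>
        ih _ (Finset.erase_ssubset (relSinks_subset _ _ hs))

end Counting

theorem IsLevelled.mono {α : Type*} {R : α → α → Prop} {σ : Equiv.Perm α} {V W : Finset α}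
    (h : IsLevelled R σ W) (hVW : V ⊆ W) : IsLevelled R σ V := by
  obtain ⟨h, hinv, hdec⟩ := h
  exact ⟨h, fun i hi => hinv i (hVW hi), fun i hi j hj => hdec i (hVW hi) j (hVW hj)⟩

/-- One round of trading: agent `i` points at agent `f i`, who owns the object intended for
`t i`, and `C` is a union of pointing cycles. -/
theorem isLevelled_iff_sdiff {α : Type*} [DecidableEq α] {R : α → α → Prop}
    {σ : Equiv.Perm α} {A C : Finset α} {f t : α → α} (hCA : C ⊆ A)
    (htA : ∀ i ∈ A, t i ∈ A) (htR : ∀ i ∈ A, t i = i ∨ R i (t i))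
    (htop : ∀ i ∈ A, t i = i → ∀ j ∈ A, ¬ R i j) (hσf : ∀ i ∈ A, σ (f i) = t i)
    (hfC : ∀ i ∈ C, f i ∈ C) (hcyc : ∀ i ∈ C, ∃ k, f^[k + 1] i = i) :
    IsLevelled R σ A ↔ (∀ i ∈ C, t i = i) ∧ IsLevelled R σ (A \ C) := by
  have hiter : ∀ k, ∀ i ∈ C, f^[k] i ∈ C := fun k => by
    induction k with
    | zero => exact fun i hi => hi
    | succ k ih => exact fun i hi => ih _ (hfC i hi)
  constructor
  · refine fun hlev => ⟨fun i hi => ?_, hlev.mono Finset.sdiff_subset⟩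
    obtain ⟨h, hinv, hdec⟩ := hlev
    have hft : ∀ i ∈ C, h (f i) = h (t i) := fun i hi => by
      rw [← hσf i (hCA hi), hinv _ (hCA (hfC i hi))]
    have hle : ∀ i ∈ C, h (f i) ≤ h i := fun i hi => by
      rw [hft i hi]
      rcases htR i (hCA hi) with h1 | h1
      · rw [h1]
      · exact (hdec i (hCA hi) _ (htA i (hCA hi)) h1).le
    have hiterle : ∀ k, ∀ i ∈ C, h (f^[k] i) ≤ h i := fun k => by
      induction k with
      | zero => exact fun i _ => le_rfl
      | succ k ih => exact fun i hi => (ih _ (hfC i hi)).trans (hle i hi)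
    obtain ⟨k, hk⟩ := hcyc i hi
    refine (htR i (hCA hi)).resolve_right fun hR => ?_
    have h1 := hdec i (hCA hi) _ (htA i (hCA hi)) hR
    have h2 := hiterle k _ (hfC i hi)
    rw [← Function.iterate_succ_apply, hk, hft i hi] at h2
    exact h1.not_ge h2
  · rintro ⟨ht, h, hinv, hdec⟩
    have hσC : ∀ i, σ i ∈ C ↔ i ∈ C := fun i => by
      constructor
      · intro hi
        have h1 : σ (f (σ i)) = σ i := (hσf _ (hCA hi)).trans (ht _ hi)
        rw [← σ.injective h1]
        exact hfC _ hi
      · intro hi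
        obtain ⟨k, hk⟩ := hcyc i hi
        have hmem := hiter k i hi
        rw [Function.iterate_succ_apply'] at hk
        have h1 := hσf _ (hCA hmem)
        rw [hk, ht _ hmem] at h1
        rwa [h1]
    refine ⟨fun i => if i ∈ C then 0 else h i + 1, fun i hi => ?_, fun i hi j hj hij => ?_⟩
    · by_cases hiC : i ∈ C
      · simp only [hσC i, hiC, if_true]
      · simp only [hσC i, hiC, if_false, hinv i (Finset.mem_sdiff.2 ⟨hi, hiC⟩)]
    · have hiC : i ∉ C := fun hiC => htop i hi (ht i hiC) j hj hij
      by_cases hjC : j ∈ C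
      · simp [hiC, hjC]
      · simp only [hiC, hjC, if_false, add_lt_add_iff_right]
        exact hdec i (Finset.mem_sdiff.2 ⟨hi, hiC⟩) j (Finset.mem_sdiff.2 ⟨hj, hjC⟩) hij

/-- The most preferred object of agent `a` in the list `O`. -/
def bestIn {n : ℕ} (rk : Fin n → Fin n → Fin n) (O : List (Fin n)) (d a : Fin n) : Fin n :=
  (O.argmin (rk a)).getD d

/-- Whether `a` returns to itself within `L` iterations of `f`. -/
def returnsWithin {α : Type*} [DecidableEq α] (f : α → α) (L : ℕ) (a : α) : Bool :=
  (List.range L).any fun k => f^[k + 1] a == a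

theorem returnsWithin_iff {α : Type*} [DecidableEq α] {f : α → α} {L : ℕ} {a : α} :
    returnsWithin f L a = true ↔ ∃ k < L, f^[k + 1] a = a := by
  simp [returnsWithin]

theorem returnsWithin_apply {α : Type*} [DecidableEq α] {f : α → α} {L : ℕ} {a : α}
    (h : returnsWithin f L a = true) : returnsWithin f L (f a) = true := by
  rw [returnsWithin_iff] at h ⊢
  obtain ⟨k, hk, hka⟩ := h
  exact ⟨k, hk, by rw [← Function.iterate_succ_apply, Function.iterate_succ_apply', hka]⟩

theorem exists_returnsWithin {α : Type*} [DecidableEq α] {f : α → α} {A : List α}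
    (hf : ∀ a ∈ A, f a ∈ A) (hA : A ≠ []) : ∃ a ∈ A, returnsWithin f A.length a = true := by
  obtain ⟨a, ha⟩ := List.exists_mem_of_ne_nil A hA
  have hiter : ∀ k, f^[k] a ∈ A := fun k => by
    induction k with
    | zero => exact ha
    | succ k ih => rw [Function.iterate_succ_apply']; exact hf _ ih
  obtain ⟨i, hi, j, hj, hij, h⟩ := Finset.exists_ne_map_eq_of_card_lt_of_maps_to
    (s := Finset.range (A.length + 1)) (t := A.toFinset) (f := fun k => f^[k] a)
    (by rw [Finset.card_range]; exact Nat.lt_succ_of_le A.toFinset_card_le)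
    (fun k _ => by simpa using hiter k)
  wlog hlt : i < j generalizing i j
  · exact this j hj i hi hij.symm h.symm (by omega)
  rw [Finset.mem_range] at hj
  refine ⟨f^[i] a, hiter i, returnsWithin_iff.2 ⟨j - i - 1, by omega, ?_⟩⟩
  rw [← Function.iterate_add_apply, show j - i - 1 + 1 + i = j by omega]
  exact h.symm

theorem lookup_map_append {α β : Type*} [DecidableEq α] (g : α → β) (C : List α)
    (l : List (α × β)) (i : α) :
    ((C.map fun a => (a, g a)) ++ l).lookup i = if i ∈ C then some (g i) else l.lookup i := by
  induction C with
  | nil => simp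
  | cons c C ih =>
    rw [List.map_cons, List.cons_append, List.lookup_cons, ih]
    by_cases h : i = c
    · simp [h]
    · simp [h, beq_false_of_ne h]

section Rules

variable {n : ℕ}

theorem TTCAux_succ_cons (rk : Fin n → Fin n → Fin n) (fuel : ℕ) (a₀ : Fin n)
    (as O : List (Fin n)) (own : Fin n → Fin n) :
    TTCAux rk (fuel + 1) (a₀ :: as) O own =
      ((((a₀ :: as).filter (returnsWithin (fun a => own (bestIn rk O a₀ a))
          (a₀ :: as).length)).map fun a => (a, bestIn rk O a₀ a)) ++
        TTCAux rk fuel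
          ((a₀ :: as).filter fun a => !returnsWithin (fun a => own (bestIn rk O a₀ a))
            (a₀ :: as).length a)
          (O.filter fun o => !((((a₀ :: as).filter (returnsWithin
            (fun a => own (bestIn rk O a₀ a)) (a₀ :: as).length)).map
              (bestIn rk O a₀)).contains o)) own) :=
  rfl

theorem SPAux_cons_cons (rk : Fin n → Fin n → Fin n) (a : Fin n) (as : List (Fin n))
    (o : Fin n) (O : List (Fin n)) :
    SPAux rk (a :: as) (o :: O) =
      (a, bestIn rk (o :: O) o a) ::
        SPAux rk as ((o :: O).erase (bestIn rk (o :: O) o a)) :=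
  rfl

variable (P : Fin n → Equiv.Perm (Fin n)) (x : Equiv.Perm (Fin n))

/-- Under the allocation `x`, agent `i` prefers the object of `j` to his own. -/
abbrev Envies (i j : Fin n) : Prop :=
  P i (x j) < P i (x i)

variable {P x}

theorem bestIn_mem {O : List (Fin n)} (hO : O ≠ []) (d a : Fin n) :
    bestIn (fun j => ⇑(P j)) O d a ∈ O := by
  obtain ⟨m, hm⟩ := Option.ne_none_iff_exists'.1 (mt List.argmin_eq_none.1 hO :
    O.argmin (P a) ≠ none)
  rw [bestIn, hm]
  exact List.argmin_mem hm

theorem bestIn_le {O : List (Fin n)} {o : Fin n} (ho : o ∈ O) (d a : Fin n) :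
    P a (bestIn (fun j => ⇑(P j)) O d a) ≤ P a o := by
  obtain ⟨m, hm⟩ := Option.ne_none_iff_exists'.1 (mt List.argmin_eq_none.1
    (List.ne_nil_of_mem ho) : O.argmin (P a) ≠ none)
  rw [bestIn, hm]
  exact List.le_of_mem_argmin ho hm

theorem bestIn_eq_iff {O : List (Fin n)} {o : Fin n} (ho : o ∈ O) (d a : Fin n) :
    bestIn (fun j => ⇑(P j)) O d a = o ↔ ∀ o' ∈ O, ¬ P a o' < P a o := by
  constructor
  · rintro rfl o' ho'
    exact (bestIn_le ho' d a).not_gt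
  · intro h
    exact (P a).injective ((bestIn_le ho d a).antisymm
      (not_lt.1 (h _ (bestIn_mem (List.ne_nil_of_mem ho) d a))))

theorem TTCAux_lookup_iff {ω : Equiv.Perm (Fin n)} (fuel : ℕ) (A O : List (Fin n))
    (hfuel : A.length ≤ fuel) (hx : ∀ i, x i ∈ O ↔ i ∈ A) (hω : ∀ i, ω i ∈ O ↔ i ∈ A) :
    (∀ i ∈ A, ((TTCAux (fun j => ⇑(P j)) fuel A O ω.symm).lookup i).getD (ω i) = x i) ↔
      IsLevelled (Envies P x) (x⁻¹ * ω) A.toFinset := by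
  induction fuel generalizing A O with
  | zero =>
    rw [List.eq_nil_of_length_eq_zero (Nat.le_zero.1 hfuel)]
    simp [IsLevelled]
  | succ fuel ih =>
    cases A with
    | nil => simp [IsLevelled]
    | cons a₀ as =>
      rw [TTCAux_succ_cons]
      set A := a₀ :: as with hA
      set top := bestIn (fun j => ⇑(P j)) O a₀ with htop
      set f : Fin n → Fin n := fun a => ω.symm (top a) with hf
      set C := A.filter (returnsWithin f A.length) with hC
      have hO : O ≠ [] := List.ne_nil_of_mem ((hx a₀).2 (by simp [hA]))
      have htopO : ∀ i, top i ∈ O := bestIn_mem hO a₀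
      have hfA : ∀ i, f i ∈ A := fun i => by rw [← hω]; simp [hf, htopO]
      have hfC : ∀ i ∈ C, f i ∈ C := fun i hi =>
        List.mem_filter.2 ⟨hfA i, returnsWithin_apply (List.mem_filter.1 hi).2⟩
      have hcyc : ∀ i ∈ C, ∃ k, f^[k + 1] i = i := fun i hi => by
        obtain ⟨k, -, hk⟩ := returnsWithin_iff.1 (List.mem_filter.1 hi).2
        exact ⟨k, hk⟩
      have hiter : ∀ k, ∀ i ∈ C, f^[k] i ∈ C := fun k => by
        induction k with
        | zero => exact fun i hi => hi
        | succ k ih => exact fun i hi => ih _ (hfC i hi)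
      have hrest : A.filter (fun a => !returnsWithin f A.length a) =
          A.filter fun a => a ∉ C := by
        refine List.filter_congr fun a ha => ?_
        simp [hC, ha]
      have hωC : ∀ i, ω i ∈ C.map top ↔ i ∈ C := fun i => by
        rw [List.mem_map]
        constructor
        · rintro ⟨j, hj, hji⟩
          have : f j = i := by simp [hf, hji]
          exact this ▸ hfC j hj
        · intro hi
          obtain ⟨k, hk⟩ := hcyc i hi
          rw [Function.iterate_succ_apply'] at hk
          exact ⟨_, hiter k i hi, (ω.symm_apply_eq).1 hk⟩
      have hlevel := isLevelled_iff_sdiff (R := Envies P x) (σ := x⁻¹ * ω) (A := A.toFinset)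
        (C := C.toFinset) (f := f) (t := fun i => x.symm (top i))
        (fun i hi => by
          rw [List.mem_toFinset] at hi ⊢
          exact (List.mem_filter.1 hi).1)
        (fun i _ => by rw [List.mem_toFinset, ← hx]; simp [htopO])
        (fun i hi => by
          rw [List.mem_toFinset, ← hx] at hi
          rcases (bestIn_le (P := P) hi a₀ i).eq_or_lt with h | h
          · exact Or.inl (x.symm_apply_eq.2 ((P i).injective h))
          · exact Or.inr (by simpa [Envies] using h))
        (fun i hi hti j hj => by
          rw [List.mem_toFinset, ← hx] at hi hj
          exact (bestIn_eq_iff hi a₀ i).1 (x.symm_apply_eq.1 hti) _ hj)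
        (fun i _ => by simp [hf])
        (fun i hi => by simpa using hfC i (by simpa using hi))
        (fun i hi => hcyc i (by simpa using hi))
      have hsdiff : A.toFinset \ C.toFinset = (A.filter fun a => a ∉ C).toFinset := by
        ext i; simp
      rw [hlevel, hrest, hsdiff]
      have hsplit : ∀ l : List (Fin n × Fin n),
          (∀ i ∈ A, (((C.map fun a => (a, top a)) ++ l).lookup i).getD (ω i) = x i) ↔
            (∀ i ∈ C.toFinset, x.symm (top i) = i) ∧
              ∀ i ∈ A.filter (fun a => a ∉ C), (l.lookup i).getD (ω i) = x i := fun l => by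
        simp only [lookup_map_append, List.mem_toFinset, List.mem_filter, decide_eq_true_eq,
          Equiv.symm_apply_eq]
        constructor
        · intro h
          refine ⟨fun i hi => ?_, fun i hi => ?_⟩
          · simpa [hi] using h i (List.mem_filter.1 hi).1
          · simpa [hi.2] using h i hi.1
        · rintro ⟨h1, h2⟩ i hi
          by_cases hiC : i ∈ C
          · simpa [hiC] using h1 i hiC
          · simpa [hiC] using h2 i ⟨hi, hiC⟩
      rw [hsplit]
      refine and_congr_right fun hCx => ih _ _ ?_ (fun i => ?_) (fun i => ?_)
      · obtain ⟨a, haA, ha⟩ := exists_returnsWithin (fun a _ => hfA a) (List.cons_ne_nil a₀ as)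
        have hlt : (A.filter fun a => a ∉ C).length < A.length :=
          List.length_filter_lt_length_iff_exists.2 ⟨a, haA, by
            rw [hC]
            simpa using And.intro haA ha⟩
        omega
      · have hxC : x i ∈ C.map top ↔ i ∈ C := by
          rw [List.mem_map]
          constructor
          · rintro ⟨j, hj, hji⟩
            have := hCx j (by simpa using hj)
            rw [hji, Equiv.symm_apply_apply] at this
            exact this ▸ hj
          · exact fun hi => ⟨i, hi, x.symm_apply_eq.1 (hCx i (by simpa using hi))⟩
        simp only [List.mem_filter, hx, List.contains_iff_mem, Bool.not_eq_true',
          decide_eq_true_eq, ← Bool.not_eq_true, hxC]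
      · simp only [List.mem_filter, hω, List.contains_iff_mem, Bool.not_eq_true',
          decide_eq_true_eq, ← Bool.not_eq_true, hωC]

theorem TTCfun_eq_iff (ω : Equiv.Perm (Fin n)) :
    TTCfun (fun j => ⇑(P j)) ω = ⇑x ↔
      x⁻¹ * ω ∈ levelledPerms (Envies P x) Finset.univ := by
  have h := TTCAux_lookup_iff (P := P) (x := x) (ω := ω) n (List.finRange n) (List.finRange n)
    (by simp) (by simp) (by simp)
  rw [List.toFinset_finRange] at h
  simp only [mem_levelledPerms, ← h, funext_iff, TTCfun]
  simp

theorem SPAux_lookup_iff (l O : List (Fin n)) (hl : l.Nodup) (hO : O.Nodup)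
    (hx : ∀ i, x i ∈ O ↔ i ∈ l) :
    (∀ i ∈ l, ((SPAux (fun j => ⇑(P j)) l O).lookup i).getD i = x i) ↔
      l.Pairwise fun a b => ¬ Envies P x a b := by
  induction l generalizing O with
  | nil => simp
  | cons a l ih =>
    cases O with
    | nil => exact absurd ((hx a).2 List.mem_cons_self) List.not_mem_nil
    | cons o O =>
      rw [List.nodup_cons] at hl
      rw [SPAux_cons_cons, List.pairwise_cons, List.forall_mem_cons]
      set top := bestIn (fun j => ⇑(P j)) (o :: O) o a with htop
      have ha : x a ∈ o :: O := (hx a).2 List.mem_cons_self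
      have hhead : top = x a ↔ ∀ b ∈ l, ¬ Envies P x a b := by
        rw [htop, bestIn_eq_iff ha]
        constructor
        · exact fun h b hb => h _ ((hx b).2 (List.mem_cons_of_mem _ hb))
        · intro h o' ho'
          rw [← x.apply_symm_apply o', hx, List.mem_cons] at ho'
          rcases ho' with h1 | h1
          · rw [← h1, x.apply_symm_apply]
            exact lt_irrefl _
          · simpa [Envies] using h _ h1
      rw [← hhead]
      have htail : ∀ i ∈ l, ∀ m : List (Fin n × Fin n),
          (((a, top) :: m).lookup i) = m.lookup i := fun i hi m => by
        rw [List.lookup_cons, beq_false_of_ne fun h : i = a => hl.1 (h ▸ hi)]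
      have hself : (((a, top) :: SPAux (fun j => ⇑(P j)) l ((o :: O).erase top)).lookup a).getD a
          = top := by simp
      rw [hself]
      refine and_congr_right fun htopx => Iff.trans
        (forall₂_congr fun i hi => by rw [htail i hi]) (ih _ hl.2 (hO.erase _) fun i => ?_)
      rw [hO.mem_erase_iff, htopx, hx, List.mem_cons, x.injective.ne_iff]
      exact ⟨fun h => h.2.resolve_left h.1, fun h => ⟨fun hia => hl.1 (hia ▸ h), Or.inr h⟩⟩

theorem SPfun_eq_iff (f : Equiv.Perm (Fin n)) :
    SPfun (fun j => ⇑(P j)) f = ⇑x ↔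
      (List.finRange n).map f ∈ linearExtensions (Envies P x) Finset.univ := by
  have hnd : ((List.finRange n).map f).Nodup := (List.nodup_finRange n).map f.injective
  have hmem : ∀ i, i ∈ (List.finRange n).map f := fun i =>
    List.mem_map.2 ⟨f.symm i, List.mem_finRange _, f.apply_symm_apply i⟩
  have h := SPAux_lookup_iff (P := P) (x := x) _ (List.finRange n) hnd (List.nodup_finRange n)
    (by simp [hmem])
  have huniv : (((List.finRange n).map f : List (Fin n)) : Multiset (Fin n)) =
      (Finset.univ : Finset (Fin n)).val :=
    (Multiset.Nodup.ext (Multiset.coe_nodup.2 hnd) Finset.univ.nodup).2 (by simp [hmem])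
  rw [mem_linearExtensions, ← h, funext_iff]
  simp only [huniv, hmem, SPfun, true_and, forall_true_left]

end Rules

/-- the core from random endowments equals the random priority rule:
for every allocation `x`, the number of endowment profiles `ω` with `TTC^ω(P) = x`
equals the number of orders `f` on the agent set with `SP^f(P) = x`. -/
theorem core_from_random_endowments_eq_random_priority {n : ℕ} (hn : 1 ≤ n)
    (P : Fin n → Equiv.Perm (Fin n)) (x : Equiv.Perm (Fin n)) :
    (Finset.univ.filter fun ω : Equiv.Perm (Fin n) => TTCfun (fun j => ⇑(P j)) ω = ⇑x).card =
      (Finset.univ.filter fun f : Equiv.Perm (Fin n) => SPfun (fun j => ⇑(P j)) ⇑f = ⇑x).card := by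
  have hTTC : (Finset.univ.filter fun ω : Equiv.Perm (Fin n) =>
      TTCfun (fun j => ⇑(P j)) ω = ⇑x).card =
        (levelledPerms (Envies P x) Finset.univ).card := by
    refine Finset.card_bij (fun ω _ => x⁻¹ * ω) (fun ω hω => ?_)
      (fun _ _ _ _ h => mul_left_cancel h) (fun σ hσ => ⟨x * σ, ?_, inv_mul_cancel_left x σ⟩)
    · exact (TTCfun_eq_iff ω).1 (Finset.mem_filter.1 hω).2
    · refine Finset.mem_filter.2 ⟨Finset.mem_univ _, (TTCfun_eq_iff _).2 ?_⟩
      rwa [inv_mul_cancel_left]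
  have hSP : (Finset.univ.filter fun f : Equiv.Perm (Fin n) =>
      SPfun (fun j => ⇑(P j)) ⇑f = ⇑x).card =
        (linearExtensions (Envies P x) Finset.univ).card := by
    refine Finset.card_bij (fun f _ => (List.finRange n).map f) (fun f hf => ?_)
      (fun f _ g _ h => ?_) (fun l hl => ?_)
    · exact (SPfun_eq_iff f).1 (Finset.mem_filter.1 hf).2
    · exact Equiv.ext fun i => List.map_inj_left.1 h i (List.mem_finRange i)
    · have hval := (mem_linearExtensions.1 hl).1
      have hnd : l.Nodup := by
        rw [← Multiset.coe_nodup, hval]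
        exact Finset.univ.nodup
      have hlen : l.length = n := by
        rw [← Multiset.coe_card, hval]
        exact Finset.card_fin n
      have hinj : Function.Injective fun i : Fin n => l.get (i.cast hlen.symm) :=
        (List.nodup_iff_injective_get.1 hnd).comp (Fin.cast_injective _)
      let f : Equiv.Perm (Fin n) := Equiv.ofBijective _ (Finite.injective_iff_bijective.1 hinj)
      have hf : (List.finRange n).map f = l :=
        List.ext_getElem (by simp [hlen]) (by simp [f])
      refine ⟨f, Finset.mem_filter.2 ⟨Finset.mem_univ _, (SPfun_eq_iff f).2 ?_⟩, hf⟩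
      rwa [hf]
  rw [hTTC, hSP]
  exact card_levelledPerms_eq_card_linearExtensions (R := Envies P x) (fun i => lt_irrefl _) _
end

section
/- For every preference profile P that is single-peaked with respect to ≺ and every endowment profile ω, the crawler allocation CR(P,ω) is Pareto efficient at P: there is no allocation y with y_i R_i CR_i(P,ω) for every agent i and y_j P_j CR_j(P,ω) for some agent j. -/
theorem findIdx2_lt_length {n : ℕ} (rk : Fin n → Fin n → Fin n) :
    ∀ {agents objects : List (Fin n)}, agents ≠ [] →
      objects.length ≤ agents.length → findIdx2 rk agents objects < agents.length
  | [], _, h, _ => absurd rfl h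
  | [_], [], _, _ => by simp [findIdx2]
  | [_], [_], _, _ => by simp [findIdx2]
  | [_], _ :: _ :: _, _, h => by simp at h
  | _ :: _ :: _, [], _, _ => by simp [findIdx2]
  | _ :: _ :: _, [_], _, _ => by simp [findIdx2]
  | a :: b :: as, o₁ :: o₂ :: os, _, h => by
      have ih := findIdx2_lt_length rk (agents := b :: as) (objects := o₂ :: os) (by simp)
        (by simpa using h)
      rw [findIdx2]
      split_ifs
      · simp
      · simpa using ih

/-- An allocation of the remaining objects that is weakly better for every remaining agent than
the outcome of the crawler coincides with that outcome. -/
theorem lookup_crawlAux_eq_some {n : ℕ} (rk : Fin n → Fin n → Fin n)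
    (hrk : ∀ i, Function.Injective (rk i)) (y d : Fin n → Fin n) (hy : Function.Injective y)
    (fuel : ℕ) (agents objects : List (Fin n)) (hagents : agents.Nodup)
    (hobjects : objects.Nodup) (hlen : agents.length = objects.length)
    (hfuel : agents.length ≤ fuel) (hmem : ∀ a ∈ agents, y a ∈ objects)
    (hle : ∀ a ∈ agents,
      rk a (y a) ≤ rk a (((crawlAux rk fuel agents objects).lookup a).getD (d a))) :
    ∀ a ∈ agents, (crawlAux rk fuel agents objects).lookup a = some (y a) := by
  induction fuel generalizing agents objects with
  | zero =>
    intro a ha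
    simp [List.length_eq_zero_iff.mp (Nat.le_zero.mp hfuel)] at ha
  | succ fuel ih =>
    match agents, objects with
    | [], _ => simp
    | _ :: _, [] => simp at hlen
    | a0 :: as, o0 :: os =>
      have ht := findIdx2_lt_length rk (List.cons_ne_nil a0 as) hlen.ge
      simp only [crawlAux] at hle ⊢
      generalize findIdx2 rk (a0 :: as) (o0 :: os) = t at *
      rw [List.getD_eq_getElem _ _ ht] at *
      have ha := List.getElem_mem ht
      have herase : (a0 :: as).eraseIdx t = (a0 :: as).erase (a0 :: as)[t] :=
        (hagents.erase_getElem t ht).symm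
      rw [herase] at hle ⊢
      clear herase
      generalize (a0 :: as)[t] = a at *
      generalize a0 :: as = agents at *
      obtain ⟨o, ho⟩ : ∃ o, (o0 :: os).argmin (rk a) = some o :=
        Option.ne_none_iff_exists'.mp (by simp [List.argmin_eq_none])
      simp only [ho, Option.getD_some] at hle ⊢
      generalize o0 :: os = objects at *
      have hya : y a = o := by
        have h := hle a ha
        simp only [List.lookup_cons_self, Option.getD_some] at h
        exact hrk a (h.antisymm (List.le_of_mem_argmin (hmem a ha) ho))
      have hlookup (b : Fin n) (hb : b ≠ a) (l : List (Fin n × Fin n)) :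
          ((a, o) :: l).lookup b = l.lookup b := by
        rw [List.lookup_cons, beq_false_of_ne hb]
      intro b hb
      by_cases hba : b = a
      · rw [hba, List.lookup_cons_self, hya]
      · rw [hlookup b hba]
        have ho_mem : o ∈ objects := List.argmin_mem ho
        refine ih _ _ (hagents.erase a) (hobjects.erase o) ?_ ?_ ?_ ?_ b
          (hagents.mem_erase_iff.mpr ⟨hba, hb⟩)
        · rw [List.length_erase_of_mem ha, List.length_erase_of_mem ho_mem, hlen]
        · rw [List.length_erase_of_mem ha]
          omega
        · intro c hc
          obtain ⟨hca, hc⟩ := hagents.mem_erase_iff.mp hc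
          exact hobjects.mem_erase_iff.mpr ⟨fun h => hca (hy (h.trans hya.symm)), hmem c hc⟩
        · intro c hc
          obtain ⟨hca, hc⟩ := hagents.mem_erase_iff.mp hc
          have h := hle c hc
          rwa [hlookup c hca] at h

theorem ownersList_perm {n : ℕ} (ω : Equiv.Perm (Fin n)) :
    ownersList ω = (List.finRange n).map ω.symm := by
  have h (o : Fin n) : (List.finRange n).find? (fun a => ω a == o) = some (ω.symm o) := by
    obtain ⟨a, ha⟩ : ∃ a, (List.finRange n).find? (fun a => ω a == o) = some a :=
      Option.isSome_iff_exists.mp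
        (List.find?_isSome.mpr ⟨ω.symm o, List.mem_finRange _, by simp⟩)
    rw [ha, Option.some_inj, Equiv.eq_symm_apply]
    simpa using List.find?_some ha
  simp only [ownersList, h]
  exact congrFun List.filterMap_eq_map' _

/-- the crawler allocation is Pareto efficient. -/
theorem crawler_pareto_efficient {n : ℕ} (hn : 1 ≤ n)
    (P : Fin n → Equiv.Perm (Fin n)) (hP : SinglePeaked P) (ω : Equiv.Perm (Fin n)) :
    ParetoEfficient P (CRfun (fun j => ⇑(P j)) ⇑ω) := by
  rintro ⟨y, hle, j, hj⟩
  have h := lookup_crawlAux_eq_some (fun j => ⇑(P j)) (fun i => (P i).injective) y ω y.injective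
    n (ownersList ω) (List.finRange n)
    (by rw [ownersList_perm]; exact (List.nodup_finRange n).map ω.symm.injective)
    (List.nodup_finRange n) (by simp [ownersList_perm]) (by simp [ownersList_perm])
    (fun _ _ => List.mem_finRange _) (fun i _ => hle i) j
    (by rw [ownersList_perm]; exact List.mem_map.mpr ⟨ω j, List.mem_finRange _, by simp⟩)
  simp [CRfun, h] at hj
end

section
/- For every n ≥ 3 there exist a preference profile P that is single-peaked with respect to ≺ and an endowment profile ω such that the crawler and Top Trading Cycles select different allocations: CR(P,ω) ≠ TTC^ω(P). -/
theorem argmin_eq_some_of_forall_lt {α β : Type*} [LinearOrder β] {f : α → β} {l : List α} {a : α}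
    (ha : a ∈ l) (h : ∀ b ∈ l, b ≠ a → f a < f b) : l.argmin f = some a := by
  cases hm : l.argmin f with
  | none => simp_all [List.argmin_eq_none]
  | some m =>
    have hle := List.le_of_mem_argmin ha (Option.mem_def.2 hm)
    by_contra hne
    exact absurd (h m (List.argmin_mem (Option.mem_def.2 hm)) (by simpa using hne)) (not_lt.2 hle)

theorem lookup_map_prodMk {α β : Type*} [BEq α] [LawfulBEq α] (f : α → β) {l : List α} {a : α}
    (ha : a ∈ l) : (l.map fun b => (b, f b)).lookup a = some (f a) := by
  induction l with
  | nil => simp at ha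
  | cons b l ih =>
    by_cases hb : a = b
    · simp [hb]
    · have hab : (a == b) = false := by simpa using hb
      rw [List.map_cons, List.lookup_cons, hab]
      exact ih ((List.mem_cons.1 ha).resolve_left hb)

theorem mem_of_lookup_eq_some {α β : Type*} [BEq α] [LawfulBEq α] {l : List (α × β)} {a : α} {b : β}
    (h : l.lookup a = some b) : (a, b) ∈ l := by
  obtain ⟨l₁, l₂, rfl, -⟩ := List.lookup_eq_some_iff.1 h
  simp

theorem snd_mem_of_mem_crawlAux {n : ℕ} {rk : Fin n → Fin n → Fin n} {fuel : ℕ}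
    {agents objects : List (Fin n)} {x : Fin n × Fin n}
    (hx : x ∈ crawlAux rk fuel agents objects) : x.2 ∈ objects := by
  induction fuel generalizing agents objects with
  | zero => simp [crawlAux] at hx
  | succ fuel ih =>
    match agents, objects with
    | [], _ => simp [crawlAux] at hx
    | _ :: _, [] => simp [crawlAux] at hx
    | a :: as, o :: os =>
      rw [crawlAux] at hx
      rcases List.mem_cons.1 hx with rfl | hx
      · cases hm : (o :: os).argmin
            (rk ((a :: as).getD (findIdx2 rk (a :: as) (o :: os)) a)) with
        | none => simp [List.argmin_eq_none] at hm
        | some m =>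
          exact List.argmin_mem (Option.mem_def.2 hm)
      · exact List.mem_of_mem_erase (ih hx)

theorem ownersList_id (n : ℕ) : ownersList (id : Fin n → Fin n) = List.finRange n := by
  have h : ∀ o : Fin n, (List.finRange n).find? (fun a => id a == o) = some o := by
    intro o
    cases hf : (List.finRange n).find? (fun a => id a == o) with
    | none => simpa using List.find?_eq_none.1 hf o (List.mem_finRange o)
    | some a => simpa using List.find?_some hf
  simp only [ownersList, h, List.filterMap_some]

/-- Agent `0` prefers larger objects, every other agent prefers smaller objects. -/
def extremePrefs (m : ℕ) (i : Fin (m + 3)) : Equiv.Perm (Fin (m + 3)) :=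
  if i = 0 then Fin.revPerm else Equiv.refl _

theorem singlePeaked_extremePrefs (m : ℕ) : SinglePeaked (extremePrefs m) := by
  intro i
  by_cases hi : i = 0
  · refine ⟨Fin.last _, fun o o' h => ?_⟩
    have h' : o' < o := h.elim And.left fun h => absurd (h.1.trans_lt h.2) (Fin.le_last _).not_gt
    simpa [extremePrefs, hi] using h'
  · refine ⟨0, fun o o' h => ?_⟩
    have h' : o < o' := h.elim (fun h => absurd (h.1.trans_le h.2) (Fin.zero_le _).not_gt) And.right
    simpa [extremePrefs, hi] using h'

theorem argmin_extremePrefs_zero (m : ℕ) :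
    (List.finRange (m + 3)).argmin (extremePrefs m 0) = some (Fin.last _) := by
  refine argmin_eq_some_of_forall_lt (List.mem_finRange _) fun b _ hb => ?_
  have hrev : b < Fin.last _ := Fin.lt_last_iff_ne_last.2 hb
  simpa only [extremePrefs, if_true, Fin.revPerm_apply, Fin.rev_lt_rev] using hrev

theorem argmin_extremePrefs_of_ne_zero {m : ℕ} {i : Fin (m + 3)} (hi : i ≠ 0) :
    (List.finRange (m + 3)).argmin (extremePrefs m i) = some 0 := by
  refine argmin_eq_some_of_forall_lt (List.mem_finRange _) fun b _ hb => ?_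
  simpa [extremePrefs, hi] using Fin.pos_iff_ne_zero.2 hb

theorem TTCfun_extremePrefs_last (m : ℕ) :
    TTCfun (fun j => ⇑(extremePrefs m j)) (Equiv.refl _) (Fin.last _) = 0 := by
  have hl : Fin.last (m + 2) ≠ 0 := Fin.last_pos.ne'
  rw [TTCfun, List.finRange_succ, TTCAux, ← List.finRange_succ]
  simp only [List.lookup_append]
  rw [lookup_map_prodMk]
  · simp [argmin_extremePrefs_of_ne_zero hl]
  · simp only [List.mem_filter, List.mem_finRange, true_and, List.any_eq_true, List.mem_range]
    refine ⟨1, by simp, ?_⟩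
    simp [argmin_extremePrefs_of_ne_zero hl, argmin_extremePrefs_zero]

theorem CRfun_extremePrefs_last_ne_zero (m : ℕ) :
    CRfun (fun j => ⇑(extremePrefs m j)) id (Fin.last (m + 2)) ≠ 0 := by
  have hl1 : Fin.last (m + 2) ≠ 1 := by simp [Fin.ext_iff]
  obtain ⟨l, hfin⟩ : ∃ l, List.finRange (m + 3) = 0 :: 1 :: 2 :: l :=
    ⟨_, by simp only [List.finRange_succ, List.map_cons]; rfl⟩
  have hidx : findIdx2 (fun j => ⇑(extremePrefs m j)) (0 :: 1 :: 2 :: l) (0 :: 1 :: 2 :: l) = 1 := by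
    have h12 : (1 : Fin (m + 3)) < 2 := by
      rw [Fin.lt_def, Fin.val_one, Fin.val_two]
      exact one_lt_two
    simp [findIdx2, extremePrefs, h12, Fin.le_last]
  have hmin : (0 :: 1 :: 2 :: l).argmin (extremePrefs m 1) = some 0 := by
    rw [← hfin]; exact argmin_extremePrefs_of_ne_zero (by simp)
  have hmem : (0 : Fin (m + 3)) ∉ (List.finRange (m + 3)).erase 0 :=
    fun h => ((List.nodup_finRange _).mem_erase_iff.1 h).1 rfl
  rw [CRfun, ownersList_id, hfin, crawlAux]
  simp only [hidx, List.getD_cons_succ, List.getD_cons_zero, hmin, Option.getD_some]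
  have hbeq : (Fin.last (m + 2) == 1) = false := by simpa using hl1
  rw [List.lookup_cons, hbeq, ← hfin]
  dsimp only
  cases hc : List.lookup (Fin.last (m + 2)) (crawlAux (fun j => ⇑(extremePrefs m j)) (m + 2)
      ((List.finRange (m + 3)).eraseIdx 1) ((List.finRange (m + 3)).erase 0)) with
  | none => simp
  | some o =>
    rintro rfl
    exact hmem (snd_mem_of_mem_crawlAux (mem_of_lookup_eq_some hc))

/-- for every `n ≥ 3` there are a single-peaked preference profile and
an endowment profile at which the crawler and TTC select different allocations. -/
theorem crawler_ne_ttc {n : ℕ} (hn : 3 ≤ n) :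
    ∃ (P : Fin n → Equiv.Perm (Fin n)) (ω : Equiv.Perm (Fin n)),
      SinglePeaked P ∧ CRfun (fun j => ⇑(P j)) ⇑ω ≠ TTCfun (fun j => ⇑(P j)) ω := by
  obtain ⟨m, rfl⟩ := Nat.exists_eq_add_of_le' hn
  refine ⟨extremePrefs m, Equiv.refl _, singlePeaked_extremePrefs m, fun h => ?_⟩
  exact CRfun_extremePrefs_last_ne_zero m
    ((congrFun h (Fin.last _)).trans (TTCfun_extremePrefs_last m))
end
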